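/- Let N ≥ 1, s ∈ (0,1), q ∈ ℝ^N, and let T : ℝ^N → ℝ^N be a surjective isometry with T(q) = q and T ∘ T = id. Let A_i, A_e ⊆ ℝ^N be disjoint measurable sets whose union is ℝ^N up to a Lebesgue-null set, assume T(A_e) ⊆ A_i up to a Lebesgue-null set, and assume the Lebesgue measure of A_i ∖ T(A_e) is positive. Then the limit as ε → 0⁺ of D(ε) := ∫_{ℝ^N∖B_ε(q)} (χ_{A_i}(y) − χ_{A_e}(y)) ‖y−q‖^{−(N+s)} dy exists in (0, +∞] and equals ∫_{A_i ∖ T(A_e)} ‖y−q‖^{−(N+s)} dy; in particular there exists ε₀ > 0 such that D(ε) > 0 for all ε ∈ (0, ε₀). -/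

import Mathlib

open MeasureTheory Set Filter

/-- A surjective isometry of a finite-dimensional real inner product space preserves volume. -/
theorem Isometry.measurePreserving_volume {E : Type*} [NormedAddCommGroup E]
    [InnerProductSpace ℝ E] [FiniteDimensional ℝ E] [MeasurableSpace E] [BorelSpace E]
    {T : E → E} (hT : Isometry T) (hTsurj : Function.Surjective T) :
    MeasurePreserving T volume volume := by
  have h := (IsometryEquiv.mk (Equiv.ofBijective T ⟨hT.injective, hTsurj⟩)
    hT).measurePreserving_euclideanHausdorffMeasure (Module.finrank ℝ E)
  rwa [InnerProductSpace.euclideanHausdorffMeasure_eq_volume] at h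

/-- The translated power `‖y - q‖ ^ (-r)` is integrable away from `q` if `r` exceeds the
dimension. -/
theorem integrableOn_norm_sub_rpow_compl_ball {E : Type*} [NormedAddCommGroup E]
    [NormedSpace ℝ E] [FiniteDimensional ℝ E] [MeasurableSpace E] [BorelSpace E]
    (μ : Measure E) [μ.IsAddHaarMeasure] {r : ℝ} (hr : (Module.finrank ℝ E : ℝ) < r) (q : E)
    {ε : ℝ} (hε : 0 < ε) :
    IntegrableOn (fun y => ‖y - q‖ ^ (-r)) (Metric.ball q ε)ᶜ μ := by
  have hr0 : 0 < r := lt_of_le_of_lt (Nat.cast_nonneg _) hr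
  have hdom : Integrable (fun y => (1 + ε⁻¹) ^ r * (1 + ‖y - q‖) ^ (-r)) μ :=
    ((integrable_one_add_norm hr).comp_sub_right q).const_mul _
  refine hdom.integrableOn.mono' (Measurable.aestronglyMeasurable (by fun_prop)) ?_
  refine (ae_restrict_iff' Metric.isOpen_ball.measurableSet.compl).2 (.of_forall fun y hy => ?_)
  have hy' : ε ≤ ‖y - q‖ := by
    simpa [dist_eq_norm] using hy
  have hpos : 0 < ‖y - q‖ := hε.trans_le hy'
  have hle : 1 + ‖y - q‖ ≤ (1 + ε⁻¹) * ‖y - q‖ := by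
    have : 1 ≤ ε⁻¹ * ‖y - q‖ := by
      rw [inv_mul_eq_div, one_le_div hε]
      exact hy'
    linarith
  rw [Real.norm_of_nonneg (by positivity)]
  calc ‖y - q‖ ^ (-r) = (1 + ε⁻¹) ^ r * ((1 + ε⁻¹) * ‖y - q‖) ^ (-r) := by
        rw [Real.mul_rpow (by positivity) hpos.le, ← mul_assoc, ← Real.rpow_add (by positivity)]
        simp
    _ ≤ (1 + ε⁻¹) ^ r * (1 + ‖y - q‖) ^ (-r) := by
        gcongr _ * ?_
        exact Real.rpow_le_rpow_of_nonpos (by positivity) hle (by linarith)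

/-- The lower integrals over the complements of balls shrinking to a null point exhaust the
lower integral. -/
theorem tendsto_setLIntegral_compl_ball {X : Type*} [MetricSpace X] [MeasurableSpace X]
    [OpensMeasurableSpace X] {μ : Measure X} {q : X} (hq : μ {q} = 0) {f : X → ENNReal}
    (hf : AEMeasurable f μ) :
    Tendsto (fun ε : ℝ => ∫⁻ y in (Metric.ball q ε)ᶜ, f y ∂μ) (nhdsWithin 0 (Ioi 0))
      (nhds (∫⁻ y, f y ∂μ)) := by
  refine AECover.lintegral_tendsto_of_countably_generated ⟨?_, fun ε =>
    Metric.isOpen_ball.measurableSet.compl⟩ hf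
  filter_upwards [measure_eq_zero_iff_ae_notMem.1 hq] with y hy
  filter_upwards [nhdsWithin_le_nhds (Iio_mem_nhds (dist_pos.2 hy))] with ε hε
  simpa using (mem_Iio.1 hε).le

/-- If `B` is contained in `A` up to a null set, the integrals over `A` and `B` differ by the
integral over `A \ B`. -/
theorem setIntegral_sub_setIntegral_of_ae_subset {X : Type*} [MeasurableSpace X]
    {μ : Measure X} {f : X → ℝ} {A B : Set X} (hB : MeasurableSet B) (hBA : μ (B \ A) = 0)
    (hf : IntegrableOn f A μ) :
    ∫ y in A, f y ∂μ - ∫ y in B, f y ∂μ = ∫ y in A \ B, f y ∂μ := by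
  have h : (A ∩ B : Set X) =ᵐ[μ] B := by
    refine (ae_le_set.2 ?_).antisymm (ae_le_set.2 ?_)
    · simp [sdiff_eq_empty.2 inter_subset_right]
    · simpa [sdiff_inter_self_eq_sdiff, sdiff_inter] using hBA
  rw [← integral_inter_add_sdiff hB hf, setIntegral_congr_set h]
  ring

/-- under the reflection-trapping hypotheses, with `|A_i \ T(A_e)| > 0`,
the principal value `lim_{ε→0⁺} D(ε)` of the truncated signed kernel integral exists in
`(0, +∞]` and equals `∫_{A_i \ T(A_e)} ‖y−q‖^{−(N+s)} dy`; in particular `D(ε) > 0` for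
all sufficiently small `ε > 0`. -/
theorem truncated_signed_kernel_integral_positive_limit
    (N : ℕ) (hN : 1 ≤ N) (s : ℝ) (hs : s ∈ Set.Ioo (0 : ℝ) 1)
    (q : EuclideanSpace ℝ (Fin N))
    (T : EuclideanSpace ℝ (Fin N) → EuclideanSpace ℝ (Fin N))
    (hT : Isometry T) (hTsurj : Function.Surjective T) (hTq : T q = q)
    (hTT : T ∘ T = id)
    (Ai Ae : Set (EuclideanSpace ℝ (Fin N)))
    (hAi : MeasurableSet Ai) (hAe : MeasurableSet Ae)
    (hdisj : Disjoint Ai Ae) (hcover : volume ((Ai ∪ Ae)ᶜ) = 0)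
    (hTAe : volume (T '' Ae \ Ai) = 0)
    (hpos : 0 < volume (Ai \ T '' Ae)) :
    0 < ∫⁻ y in Ai \ T '' Ae, ENNReal.ofReal (‖y - q‖ ^ (-((N : ℝ) + s))) ∧
    Tendsto
      (fun ε : ℝ => ENNReal.ofReal
        (∫ y in (Metric.ball q ε)ᶜ,
          (Ai.indicator (fun _ => (1 : ℝ)) y - Ae.indicator (fun _ => (1 : ℝ)) y) *
            ‖y - q‖ ^ (-((N : ℝ) + s))))
      (nhdsWithin 0 (Set.Ioi 0))
      (nhds (∫⁻ y in Ai \ T '' Ae, ENNReal.ofReal (‖y - q‖ ^ (-((N : ℝ) + s))))) ∧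
    ∃ ε₀ > (0 : ℝ), ∀ ε ∈ Set.Ioo (0 : ℝ) ε₀,
      0 < ∫ y in (Metric.ball q ε)ᶜ,
        (Ai.indicator (fun _ => (1 : ℝ)) y - Ae.indicator (fun _ => (1 : ℝ)) y) *
          ‖y - q‖ ^ (-((N : ℝ) + s)) := by
  have hinv : ∀ y, T (T y) = y := congrFun hTT
  have himg : T '' Ae = T ⁻¹' Ae :=
    congrFun (image_eq_preimage_of_inverse hinv hinv) Ae
  rw [himg] at hTAe hpos ⊢
  have hTm : MeasurePreserving T volume volume := hT.measurePreserving_volume hTsurj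
  have hB : MeasurableSet (T ⁻¹' Ae) := hTm.measurable hAe
  have hTn : ∀ y, ‖T y - q‖ = ‖y - q‖ := fun y => by
    simpa [dist_eq_norm, hTq] using hT.dist_eq y q
  have : Nonempty (Fin N) := ⟨⟨0, hN⟩⟩
  set k : EuclideanSpace ℝ (Fin N) → ℝ := fun y => ‖y - q‖ ^ (-((N : ℝ) + s)) with hk
  have hkm : Measurable k := by fun_prop
  have hk0 : ∀ y, 0 ≤ k y := fun y => by positivity
  have hkT : ∀ y, k (T y) = k y := fun y => by simp only [hk, hTn]
  have hpos' : 0 < ∫⁻ y in Ai \ T ⁻¹' Ae, ENNReal.ofReal (k y) := by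
    rw [setLIntegral_pos_iff hkm.ennreal_ofReal]
    refine hpos.trans_le ((measure_sdiff_null (measure_singleton q)).symm.le.trans
      (measure_mono fun y hy => ⟨?_, hy.1⟩))
    have : 0 < ‖y - q‖ := norm_pos_iff.2 (sub_ne_zero.2 hy.2)
    exact (ENNReal.ofReal_pos.2 (Real.rpow_pos_of_pos this _)).ne'
  have hD : ∀ ε > 0, ENNReal.ofReal (∫ y in (Metric.ball q ε)ᶜ,
      (Ai.indicator (fun _ => (1 : ℝ)) y - Ae.indicator (fun _ => (1 : ℝ)) y) * k y) =
      ∫⁻ y in (Metric.ball q ε)ᶜ, ENNReal.ofReal (k y) ∂volume.restrict (Ai \ T ⁻¹' Ae) := by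
    intro ε hε
    have hE : MeasurableSet (Metric.ball q ε)ᶜ := Metric.isOpen_ball.measurableSet.compl
    have hki : IntegrableOn k (Metric.ball q ε)ᶜ :=
      integrableOn_norm_sub_rpow_compl_ball volume (by simpa using hs.1) q hε
    have hTE : T ⁻¹' (Metric.ball q ε)ᶜ = (Metric.ball q ε)ᶜ := by
      ext y
      simp [dist_eq_norm, hTn]
    have hrefl : ∫ y in Ae, k y ∂volume.restrict (Metric.ball q ε)ᶜ =
        ∫ y in T ⁻¹' Ae, k y ∂volume.restrict (Metric.ball q ε)ᶜ := by
      rw [Measure.restrict_restrict hAe, Measure.restrict_restrict hB,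
        ← hTm.setIntegral_preimage_emb hT.isClosedEmbedding.measurableEmbedding,
        preimage_inter, hTE]
      simp only [hkT]
    have hsplit : ∀ y, (Ai.indicator (fun _ => (1 : ℝ)) y - Ae.indicator (fun _ => (1 : ℝ)) y) * k y
        = Ai.indicator k y - Ae.indicator k y := fun y => by
      by_cases hyi : y ∈ Ai <;> by_cases hye : y ∈ Ae <;> simp [hyi, hye]
    simp only [hsplit]
    rw [integral_sub (hki.indicator hAi) (hki.indicator hAe), integral_indicator hAi,
      integral_indicator hAe, hrefl, setIntegral_sub_setIntegral_of_ae_subset hB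
        (Measure.absolutelyContinuous_of_le Measure.restrict_le_self hTAe) hki.integrableOn,
      ofReal_integral_eq_lintegral_ofReal hki.integrableOn (.of_forall hk0),
      Measure.restrict_restrict (hAi.diff hB), Measure.restrict_restrict hE, inter_comm]
  have hlim := (tendsto_setLIntegral_compl_ball (μ := volume.restrict (Ai \ T ⁻¹' Ae)) (q := q)
    (Measure.absolutelyContinuous_of_le Measure.restrict_le_self (measure_singleton q))
    hkm.ennreal_ofReal.aemeasurable).congr'
    (eventually_mem_nhdsWithin.mono fun ε hε => (hD ε hε).symm)
  refine ⟨hpos', hlim, ?_⟩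
  obtain ⟨ε₀, hε₀, h⟩ :=
    mem_nhdsGT_iff_exists_Ioo_subset.1 (hlim.eventually (lt_mem_nhds hpos'))
  exact ⟨ε₀, hε₀, fun ε hε => ENNReal.ofReal_pos.1 (h hε)⟩
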